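/- Let a ∈ ℝ and b ∈ ℂ, and let L(a,b) be the 3×3 complex matrix with rows (a, b, 0), (b/2, −2a, −\bar{b}/2), (0, −\bar{b}, 0). Then L(a,b) has rank 2 and nonzero trace if and only if a ≠ 0 and b = 0. -/

import Mathlib

open Complex Matrix

noncomputable section

/-- The matrix `L(a,b)` with rows `(a, b, 0)`, `(b/2, −2a, −b̄/2)`, `(0, −b̄, 0)`. -/
def Lmat (a : ℝ) (b : ℂ) : Matrix (Fin 3) (Fin 3) ℂ :=
  !![(a : ℂ), b, 0;
     b / 2, -2 * (a : ℂ), -starRingEnd ℂ b / 2;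
     0, -starRingEnd ℂ b, 0]

theorem det_Lmat (a : ℝ) (b : ℂ) :
    (Lmat a b).det = -(a : ℂ) * (starRingEnd ℂ b) ^ 2 / 2 := by
  simp [Lmat, det_fin_three]
  ring

theorem trace_Lmat (a : ℝ) (b : ℂ) : (Lmat a b).trace = -(a : ℂ) := by
  simp [Lmat, trace_fin_three]
  ring

theorem Lmat_zero_right (a : ℝ) :
    Lmat a 0 = diagonal ![(a : ℂ), -2 * (a : ℂ), 0] := by
  ext i j
  fin_cases i <;> fin_cases j <;> simp [Lmat]

theorem rank_Lmat_zero_right {a : ℝ} (ha : a ≠ 0) : (Lmat a 0).rank = 2 := by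
  rw [Lmat_zero_right, rank_diagonal, Fintype.card_subtype]
  simp [Finset.filter, Fin.univ_succ, ha]

theorem stmt_6 (a : ℝ) (b : ℂ) :
    ((Lmat a b).rank = 2 ∧ Matrix.trace (Lmat a b) ≠ 0) ↔ a ≠ 0 ∧ b = 0 := by
  rw [trace_Lmat, neg_ne_zero, Complex.ofReal_ne_zero]
  constructor
  · rintro ⟨hrank, ha⟩
    refine ⟨ha, ?_⟩
    by_contra hb
    have hdet : IsUnit (Lmat a b).det := by
      simp [det_Lmat, ha, hb]
    have h := rank_of_isUnit (Lmat a b) ((isUnit_iff_isUnit_det _).mpr hdet)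
    simp [hrank] at h
  · rintro ⟨ha, rfl⟩
    exact ⟨rank_Lmat_zero_right ha, ha⟩
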